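/- Let w be a string, l1, l2 ≥ 1, and natural numbers n1, n2 with n1 < n2 < n1 + l1 < n2 + l2 ≤ |w| (two overlapping deletes, the first starting and ending strictly before the second). Then deleting l1 characters at n1 and then deleting the remaining overhang, namely n2+l2-(n1+l1) characters at position n1, yields the same string as deleting l2 characters at n2 and then deleting the remaining n2-n1 characters at position n1; that is, del(n1, n2+l2-n1-l1)(del(n1, l1)(w)) = del(n1, n2-n1)(del(n2, l2)(w)). -/

import Mathlib

/-- Delete `l` characters starting at position `n` in the string `w`. -/
def del {α : Type*} (n l : ℕ) (w : List α) : List α :=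
  w.take n ++ w.drop (n + l)

/-- Two overlapping deletes, the first starting and ending strictly before
    the second: each is transformed into the non-overlapping remainder. -/
theorem deletes_overlapping_converge {α : Type*}
    (w : List α) (l1 l2 n1 n2 : ℕ)
    (hl1 : 1 ≤ l1) (hl2 : 1 ≤ l2)
    (h1 : n1 < n2) (h2 : n2 < n1 + l1) (h3 : n1 + l1 < n2 + l2)
    (h4 : n2 + l2 ≤ w.length) :
    del n1 (n2 + l2 - n1 - l1) (del n1 l1 w) = del n1 (n2 - n1) (del n2 l2 w) := by
  have hn1 : n1 ≤ w.length := by omega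
  have hn2 : n2 ≤ w.length := by omega
  apply List.ext_getElem?
  intro i
  simp only [del, List.getElem?_append, List.getElem?_take, List.getElem?_drop,
    List.length_append, List.length_take, List.length_drop]
  grind
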